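/- arXiv:2410.14190 — 2 statements merged into one kernel-verified Lean document; each statement's English description precedes it below -/
import Mathlib

section
/- For |q|<1, ∑_{n≥0} q^{2n+1} (-q^{2n+2};q^2)_∞ (q^{2n+2};q^2)_∞ / (q^{2n+1};q^2)_∞ = q·ν(-q), where ν(q) = ∑_{n≥0} (-q)^n (q;q^2)_n. -/
open scoped BigOperators

noncomputable def qPoch (a q : ℂ) (n : ℕ) : ℂ := ∏ j ∈ Finset.range n, (1 - a * q ^ j)

noncomputable def qPochInf (a q : ℂ) : ℂ := ∏' j : ℕ, (1 - a * q ^ j)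

open Filter Topology

lemma summable_qp (a p : ℂ) (hp : ‖p‖ < 1) : Summable (fun j : ℕ => ‖-(a * p ^ j)‖) := by
  have h := (summable_geometric_of_lt_one (norm_nonneg p) hp).mul_left ‖a‖
  refine h.congr fun j => ?_
  rw [norm_neg, norm_mul, norm_pow]

lemma multipliable_qp (a p : ℂ) (hp : ‖p‖ < 1) : Multipliable (fun j : ℕ => 1 - a * p ^ j) := by
  have h := multipliable_one_add_of_summable (summable_qp a p hp)
  simpa [sub_eq_add_neg] using h

lemma tendsto_qp (a p : ℂ) (hp : ‖p‖ < 1) :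
    Tendsto (fun n => qPoch a p n) atTop (𝓝 (qPochInf a p)) :=
  (multipliable_qp a p hp).tendsto_prod_tprod_nat

lemma factor_ne (a p : ℂ) (ha : ‖a‖ < 1) (hp : ‖p‖ < 1) (j : ℕ) : 1 - a * p ^ j ≠ 0 := by
  intro h
  have h1 : a * p ^ j = 1 := (sub_eq_zero.mp h).symm
  have h2 : ‖a * p ^ j‖ < 1 := by
    rw [norm_mul, norm_pow]
    exact lt_of_le_of_lt (mul_le_of_le_one_right (norm_nonneg a)
      (pow_le_one₀ (norm_nonneg p) hp.le)) ha
  rw [h1] at h2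
  simp at h2

lemma qPoch_ne (a p : ℂ) (ha : ‖a‖ < 1) (hp : ‖p‖ < 1) (n : ℕ) : qPoch a p n ≠ 0 :=
  Finset.prod_ne_zero_iff.mpr fun j _ => factor_ne a p ha hp j

lemma qPochInf_ne (a p : ℂ) (ha : ‖a‖ < 1) (hp : ‖p‖ < 1) : qPochInf a p ≠ 0 := by
  have h := tprod_one_add_ne_zero_of_summable (f := fun j : ℕ => -(a * p ^ j))
    (fun j => by simpa [sub_eq_add_neg] using factor_ne a p ha hp j) (summable_qp a p hp)
  simpa [qPochInf, sub_eq_add_neg] using h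

lemma qPoch_split (a p : ℂ) (hp : ‖p‖ < 1) (n : ℕ) :
    qPoch a p n * qPochInf (a * p ^ n) p = qPochInf a p := by
  have h := Multipliable.prod_mul_tprod_nat_mul' (f := fun j : ℕ => 1 - a * p ^ j) (k := n)
    (by
      refine (multipliable_qp (a * p ^ n) p hp).congr fun j => ?_
      ring)
  rw [← show _ = qPochInf a p from h]
  unfold qPoch qPochInf
  congr 1
  refine tprod_congr fun j => ?_
  ring

lemma qPoch_succ (a p : ℂ) (n : ℕ) : qPoch a p (n + 1) = qPoch a p n * (1 - a * p ^ n) :=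
  Finset.prod_range_succ _ _

lemma bounded_A (a p : ℂ) (hp : ‖p‖ < 1) : ∃ C : ℝ, ∀ m, ‖qPoch a p m / qPoch p p m‖ ≤ C := by
  have h := (tendsto_qp a p hp).div (tendsto_qp p p hp) (qPochInf_ne p p hp hp)
  obtain ⟨C, hC⟩ := (Metric.isBounded_range_of_tendsto _ h).exists_norm_le
  exact ⟨C, fun m => hC _ ⟨m, rfl⟩⟩

lemma summable_A (a p z : ℂ) (hp : ‖p‖ < 1) (hz : ‖z‖ < 1) :
    Summable (fun m : ℕ => qPoch a p m / qPoch p p m * z ^ m) := by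
  obtain ⟨C, hC⟩ := bounded_A a p hp
  refine Summable.of_norm_bounded
    ((summable_geometric_of_lt_one (norm_nonneg z) hz).mul_left C) fun m => ?_
  rw [norm_mul, norm_pow]
  exact mul_le_mul_of_nonneg_right (hC m) (by positivity)

lemma norm_zp (p z : ℂ) (hp : ‖p‖ < 1) (hz : ‖z‖ < 1) (n : ℕ) : ‖z * p ^ n‖ < 1 := by
  rw [norm_mul, norm_pow]
  exact lt_of_le_of_lt (mul_le_of_le_one_right (norm_nonneg z)
      (pow_le_one₀ (norm_nonneg p) hp.le)) hz

lemma func_eq (a p z : ℂ) (hp : ‖p‖ < 1) (hz : ‖z‖ < 1) :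
    (1 - z) * ∑' m : ℕ, qPoch a p m / qPoch p p m * z ^ m =
      (1 - a * z) * ∑' m : ℕ, qPoch a p m / qPoch p p m * (z * p) ^ m := by
  have hzp : ‖z * p‖ < 1 := by simpa using norm_zp p z hp hz 1
  have s1 := summable_A a p z hp hz
  have s2 := summable_A a p (z * p) hp hzp
  have e1 := s1.tsum_eq_zero_add
  have e2 := s2.tsum_eq_zero_add
  have t1 := (summable_nat_add_iff 1).mpr s1
  have t2 := (summable_nat_add_iff 1).mpr s2
  have key : ∑' m : ℕ, qPoch a p (m + 1) / qPoch p p (m + 1) * z ^ (m + 1)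
      - ∑' m : ℕ, qPoch a p (m + 1) / qPoch p p (m + 1) * (z * p) ^ (m + 1)
      = z * (∑' m : ℕ, qPoch a p m / qPoch p p m * z ^ m)
        - a * z * ∑' m : ℕ, qPoch a p m / qPoch p p m * (z * p) ^ m := by
    rw [← t1.tsum_sub t2, ← tsum_mul_left, ← tsum_mul_left,
      ← (s1.mul_left z).tsum_sub (s2.mul_left (a * z))]
    refine tsum_congr fun m => ?_
    have h1 := qPoch_ne p p hp hp m
    have h2 := factor_ne p p hp hp m
    rw [qPoch_succ, qPoch_succ]
    simp only [pow_succ, mul_pow]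
    generalize p ^ m = x at *
    have h3 : 1 - x * p ≠ 0 := by rwa [mul_comm]
    field_simp
  simp only [pow_zero] at e1 e2
  linear_combination e1 - e2 + key

lemma qbin_iter (a p z : ℂ) (hp : ‖p‖ < 1) (hz : ‖z‖ < 1) (N : ℕ) :
    qPoch z p N * ∑' m : ℕ, qPoch a p m / qPoch p p m * z ^ m =
      qPoch (a * z) p N * ∑' m : ℕ, qPoch a p m / qPoch p p m * (z * p ^ N) ^ m := by
  induction N with
  | zero => simp [qPoch]
  | succ N ih =>
    have h := func_eq a p (z * p ^ N) hp (norm_zp p z hp hz N)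
    rw [show z * p ^ N * p = z * p ^ (N + 1) by ring] at h
    rw [qPoch_succ, qPoch_succ]
    linear_combination (1 - z * p ^ N) * ih + qPoch (a * z) p N * h

lemma qbin (a p z : ℂ) (hp : ‖p‖ < 1) (hz : ‖z‖ < 1) :
    ∑' m : ℕ, qPoch a p m / qPoch p p m * z ^ m = qPochInf (a * z) p / qPochInf z p := by
  obtain ⟨C, hC⟩ := bounded_A a p hp
  have hlim : Tendsto (fun N : ℕ => ∑' m : ℕ, qPoch a p m / qPoch p p m * (z * p ^ N) ^ m) atTop
      (𝓝 (∑' m : ℕ, if m = 0 then (1 : ℂ) else 0)) := by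
    refine tendsto_tsum_of_dominated_convergence
      ((summable_geometric_of_lt_one (norm_nonneg z) hz).mul_left C) (fun m => ?_)
      (Eventually.of_forall fun N m => ?_)
    · have h0 : Tendsto (fun N : ℕ => z * p ^ N) atTop (𝓝 0) := by
        simpa using (tendsto_pow_atTop_nhds_zero_of_norm_lt_one hp).const_mul z
      have h1 := (h0.pow m).const_mul (qPoch a p m / qPoch p p m)
      rcases eq_or_ne m 0 with rfl | hm
      · simp [qPoch]
      · simpa [hm] using h1
    · rw [norm_mul, norm_pow]
      refine mul_le_mul (hC m) (pow_le_pow_left₀ (norm_nonneg _) ?_ m) (by positivity)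
        ((norm_nonneg _).trans (hC m))
      rw [norm_mul, norm_pow]
      exact mul_le_of_le_one_right (norm_nonneg z) (pow_le_one₀ (norm_nonneg p) hp.le)
  rw [tsum_ite_eq] at hlim
  have hl := (tendsto_qp z p hp).mul_const (∑' m : ℕ, qPoch a p m / qPoch p p m * z ^ m)
  have hr := (tendsto_qp (a * z) p hp).mul hlim
  simp only [← qbin_iter a p z hp hz] at hr
  have := tendsto_nhds_unique hl hr
  rw [eq_div_iff (qPochInf_ne z p hz hp)]
  linear_combination this

theorem stmt_9 (q : ℂ) (hq : ‖q‖ < 1) :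
    (∑' n : ℕ, q ^ (2 * n + 1) * qPochInf (-q ^ (2 * n + 2)) (q ^ 2) *
        qPochInf (q ^ (2 * n + 2)) (q ^ 2) / qPochInf (q ^ (2 * n + 1)) (q ^ 2)) =
      q * ∑' n : ℕ, q ^ n * qPoch (-q) (q ^ 2) n := by
  obtain ⟨p, hpd⟩ : ∃ p : ℂ, p = q ^ 2 := ⟨_, rfl⟩
  have hp : ‖p‖ < 1 := by
    rw [hpd, norm_pow]; exact pow_lt_one₀ (norm_nonneg q) hq two_ne_zero
  rw [← hpd]
  have hP := qPochInf_ne p p hp hp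
  let f : ℕ → ℕ → ℂ := fun n m => q * qPochInf p p * (p ^ n * (qPoch 0 p n / qPoch p p n)) *
    (qPoch (-q) p m / qPoch p p m * (q * p ^ n) ^ m)
  have q0 : ∀ n, qPoch 0 p n = 1 := fun n => by simp [qPoch]
  have qi0 : qPochInf 0 p = 1 := by simp [qPochInf]
  have hL : ∀ n : ℕ, q ^ (2 * n + 1) * qPochInf (-q ^ (2 * n + 2)) p *
        qPochInf (q ^ (2 * n + 2)) p / qPochInf (q ^ (2 * n + 1)) p = ∑' m, f n m := by
    intro n
    have e1 : q ^ (2 * n + 1) = q * p ^ n := by rw [hpd]; ring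
    have e2 : q ^ (2 * n + 2) = p * p ^ n := by rw [hpd]; ring
    have e3 : -q ^ (2 * n + 2) = -q * (q * p ^ n) := by rw [hpd]; ring
    rw [e3, e2, e1]
    simp only [f]
    rw [tsum_mul_left, qbin (-q) p _ hp (norm_zp p q hp hq n), q0, ← qPoch_split p p hp n]
    have := qPoch_ne p p hp hp n
    field_simp
  have hR : ∀ m : ℕ, ∑' n, f n m = q * (q ^ m * qPoch (-q) p m) := by
    intro m
    have e : ∀ n, f n m = q * qPochInf p p * (qPoch (-q) p m / qPoch p p m * q ^ m) *
        (qPoch 0 p n / qPoch p p n * (p * p ^ m) ^ n) := by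
      intro n
      simp only [f]
      ring
    simp only [e]
    rw [tsum_mul_left, qbin 0 p _ hp (norm_zp p p hp hp m), zero_mul, qi0,
      ← qPoch_split p p hp m]
    have h1 := qPoch_ne p p hp hp m
    have h2 := qPochInf_ne _ p (norm_zp p p hp hp m) hp
    field_simp
  have hs : Summable (Function.uncurry f) := by
    obtain ⟨C, hC⟩ := bounded_A (-q) p hp
    obtain ⟨D, hD⟩ := bounded_A 0 p hp
    have hC0 := (norm_nonneg _).trans (hC 0)
    have hD0 := (norm_nonneg _).trans (hD 0)
    have g := ((summable_geometric_of_lt_one (norm_nonneg p) hp).mul_of_nonneg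
      (summable_geometric_of_lt_one (norm_nonneg q) hq) (fun _ => by positivity)
      (fun _ => by positivity)).mul_left (‖q * qPochInf p p‖ * D * C)
    refine Summable.of_norm_bounded g ?_
    rintro ⟨n, m⟩
    simp only [Function.uncurry, f]
    rw [norm_mul, norm_mul (q * qPochInf p p), norm_mul (p ^ n), norm_mul (_ / _) (_ ^ m),
      norm_pow p, norm_pow _ m]
    have h1 : ‖q * p ^ n‖ ≤ ‖q‖ := by
      rw [norm_mul, norm_pow]
      exact mul_le_of_le_one_right (norm_nonneg q) (pow_le_one₀ (norm_nonneg p) hp.le)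
    calc _ ≤ ‖q * qPochInf p p‖ * (‖p‖ ^ n * D) * (C * ‖q‖ ^ m) := by
          gcongr
          · exact hD n
          · exact hC m
      _ = _ := by ring
  rw [tsum_congr hL, ← hs.tsum_comm, tsum_congr hR, tsum_mul_left]
end

section
/- For |q|<1, ∑_{n≥0} q^{2n+1} (-q^{2n+4};q^2)_∞ (-q^{2n+2};q^2)_∞ / (q^{2n+1};q^2)_∞^2 = 2q (-q^2;q)_∞^2 (-q^2;q^2)_∞^2 - q/(1+q)^2. -/
open scoped BigOperators

open Filter Topology

theorem aux_summable (a q : ℂ) (hq : ‖q‖ < 1) : Summable fun j : ℕ => ‖-(a * q ^ j)‖ := by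
  simp only [norm_neg, norm_mul, norm_pow]
  exact (summable_geometric_of_lt_one (norm_nonneg _) hq).mul_left _

theorem aux_mult (a q : ℂ) (hq : ‖q‖ < 1) : Multipliable fun j : ℕ => (1 - a * q ^ j) := by
  simpa [sub_eq_add_neg] using multipliable_one_add_of_summable (aux_summable a q hq)

theorem aux_term_ne (a q : ℂ) (ha : ‖a‖ < 1) (hq : ‖q‖ < 1) (j : ℕ) : 1 - a * q ^ j ≠ 0 := by
  intro h
  have h1 : a * q ^ j = 1 := (sub_eq_zero.mp h).symm
  have h2 : ‖a * q ^ j‖ < 1 := by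
    rw [norm_mul, norm_pow]
    calc ‖a‖ * ‖q‖ ^ j ≤ ‖a‖ * 1 := by
          gcongr
          exact pow_le_one₀ (norm_nonneg _) hq.le
      _ < 1 := by simpa using ha
  rw [h1] at h2
  simp at h2

theorem aux_ne (a q : ℂ) (ha : ‖a‖ < 1) (hq : ‖q‖ < 1) : qPochInf a q ≠ 0 := by
  have := tprod_one_add_ne_zero_of_summable (f := fun j : ℕ => -(a * q ^ j))
    (fun j => by simpa [sub_eq_add_neg] using aux_term_ne a q ha hq j) (aux_summable a q hq)
  simpa [qPochInf, sub_eq_add_neg] using this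

theorem aux_shift (a q : ℂ) (hq : ‖q‖ < 1) (n : ℕ) :
    (∏ i ∈ Finset.range n, (1 - a * q ^ i)) * qPochInf (a * q ^ n) q = qPochInf a q := by
  have h := aux_mult (a * q ^ n) q hq
  have e : (fun j : ℕ => (1 - a * q ^ n * q ^ j)) = fun j => (1 - a * q ^ (j + n)) := by
    funext j; ring
  rw [e] at h
  have := Multipliable.prod_mul_tprod_nat_mul' (f := fun j : ℕ => (1 - a * q ^ j)) h
  simp only [qPochInf]
  rw [e]
  exact this

theorem aux_one (a q : ℂ) (hq : ‖q‖ < 1) :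
    qPochInf a q = (1 - a) * qPochInf (a * q) q := by
  simpa using (aux_shift a q hq 1).symm

theorem aux_tendsto (a q : ℂ) (ha : ‖a‖ < 1) (hq : ‖q‖ < 1) :
    Tendsto (fun n : ℕ => qPochInf (a * q ^ n) q) atTop (𝓝 1) := by
  have h1 := (aux_mult a q hq).tendsto_prod_tprod_nat
  have h0 : qPochInf a q ≠ 0 := aux_ne a q ha hq
  have h2 := (tendsto_const_nhds (x := qPochInf a q)).div h1 h0
  rw [show (∏' j : ℕ, (1 - a * q ^ j)) = qPochInf a q from rfl, div_self h0] at h2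
  refine h2.congr fun n => ?_
  have hp : (∏ i ∈ Finset.range n, (1 - a * q ^ i)) ≠ 0 :=
    Finset.prod_ne_zero_iff.mpr fun i _ => aux_term_ne a q ha hq i
  simp only [Pi.div_apply]
  rw [div_eq_iff hp, ← aux_shift a q hq n, mul_comm]

/-- Euler: `(-q;q)_∞ (q;q²)_∞ = 1`. -/
theorem aux_euler (q : ℂ) (hq : ‖q‖ < 1) : qPochInf (-q) q * qPochInf q (q ^ 2) = 1 := by
  have hq2 : ‖q ^ 2‖ < 1 := by
    rw [norm_pow]; exact pow_lt_one₀ (norm_nonneg _) hq two_ne_zero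
  have h1 : qPochInf (-q) q * qPochInf q q = qPochInf (q ^ 2) (q ^ 2) := by
    unfold qPochInf
    rw [← (aux_mult (-q) q hq).tprod_mul (aux_mult q q hq)]
    congr 1; funext j; ring
  have h2 : qPochInf q (q ^ 2) * qPochInf (q ^ 2) (q ^ 2) = qPochInf q q := by
    unfold qPochInf
    have he : (fun j : ℕ => 1 - q * (q ^ 2) ^ j) = fun j => 1 - q * q ^ (2 * j) := by
      funext j; ring
    have ho : (fun j : ℕ => 1 - q ^ 2 * (q ^ 2) ^ j) = fun j => 1 - q * q ^ (2 * j + 1) := by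
      funext j; ring
    have me := aux_mult q (q ^ 2) hq2
    have mo := aux_mult (q ^ 2) (q ^ 2) hq2
    rw [he] at me ⊢
    rw [ho] at mo ⊢
    exact tprod_even_mul_odd (f := fun j : ℕ => 1 - q * q ^ j) me mo
  have h3 := aux_ne (q ^ 2) (q ^ 2) hq2 hq2
  rw [← h2, ← mul_assoc] at h1
  exact mul_right_cancel₀ h3 (by rw [h1, one_mul])

theorem stmt_10 (q : ℂ) (hq : ‖q‖ < 1) :
    (∑' n : ℕ, q ^ (2 * n + 1) * qPochInf (-q ^ (2 * n + 4)) (q ^ 2) *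
        qPochInf (-q ^ (2 * n + 2)) (q ^ 2) / (qPochInf (q ^ (2 * n + 1)) (q ^ 2)) ^ 2) =
      2 * q * (qPochInf (-q ^ 2) q) ^ 2 * (qPochInf (-q ^ 2) (q ^ 2)) ^ 2 -
        q / (1 + q) ^ 2 := by
  have hpow : ∀ k : ℕ, k ≠ 0 → ‖q ^ k‖ < 1 := fun k hk => by
    rw [norm_pow]; exact pow_lt_one₀ (norm_nonneg _) hq hk
  have hq2 := hpow 2 two_ne_zero
  have h1q : 1 + q ≠ 0 := by
    have := aux_term_ne (-q) q (by simpa using hq) hq 0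
    simpa using this
  set A : ℕ → ℂ := fun n => qPochInf (-q ^ (2 * n + 2)) (q ^ 2) with hA
  set B : ℕ → ℂ := fun n => qPochInf (q ^ (2 * n + 1)) (q ^ 2) with hB
  have hAs : ∀ n, A n = (1 + q ^ (2 * n + 2)) * A (n + 1) := fun n => by
    simp only [hA]
    rw [aux_one _ _ hq2]
    congr 2 <;> ring
  have hBs : ∀ n, B n = (1 - q ^ (2 * n + 1)) * B (n + 1) := fun n => by
    simp only [hB]
    rw [aux_one _ _ hq2]
    congr 2; ring
  have hBne : ∀ n, B n ≠ 0 := fun n => aux_ne _ _ (hpow _ (by omega)) hq2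
  have hAt : Tendsto A atTop (𝓝 1) := by
    refine (aux_tendsto (-q ^ 2) (q ^ 2) (by simpa using hq2) hq2).congr fun n => ?_
    simp only [hA]; congr 1; ring
  have hBt : Tendsto B atTop (𝓝 1) := by
    refine (aux_tendsto q (q ^ 2) hq hq2).congr fun n => ?_
    simp only [hB]; congr 1; ring
  have hAt1 : Tendsto (fun n => A (n + 1)) atTop (𝓝 1) := hAt.comp (tendsto_add_atTop_nat 1)
  have hpt : Tendsto (fun n : ℕ => q ^ (2 * n)) atTop (𝓝 0) := by
    simp only [pow_mul]
    exact tendsto_pow_atTop_nhds_zero_of_norm_lt_one hq2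
  set T : ℕ → ℂ := fun n => q * (1 + q ^ (2 * n)) / (1 + q) ^ 2 * (A n ^ 2 / B n ^ 2) with hT
  have hTt : Tendsto T atTop (𝓝 (q / (1 + q) ^ 2)) := by
    have := (((hpt.const_add 1).const_mul q).div_const ((1 + q) ^ 2)).mul
      ((hAt.pow 2).div (hBt.pow 2) (by simp))
    simpa using this
  set t : ℕ → ℂ := fun n => q ^ (2 * n + 1) * A (n + 1) * A n / B n ^ 2 with ht
  have htel : ∀ n, t n = T n - T (n + 1) := fun n => by
    have hb := hBne (n + 1)
    have hb0 := hBne n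
    have hc : 1 - q ^ (2 * n + 1) ≠ 0 := fun h => hb0 (by rw [hBs, h, zero_mul])
    simp only [ht, hT]
    rw [hAs n, hBs n]
    field_simp
    ring
  have hsum : Summable t := by
    have hg : Tendsto (fun n => A (n + 1) * A n / B n ^ 2) atTop (𝓝 1) := by
      have h := (hAt1.mul hAt).div (hBt.pow 2) (by simp)
      simp only [mul_one, one_pow, div_one] at h
      exact h
    have hO := (Asymptotics.isBigO_refl (fun n : ℕ => q ^ (2 * n + 1)) atTop).mul
      (hg.isBigO_one ℂ)
    refine summable_of_isBigO_nat (g := fun n : ℕ => ‖q ^ (2 * n + 1)‖) ?_ ?_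
    · have : (fun n : ℕ => ‖q ^ (2 * n + 1)‖) = fun n => ‖-(q * (q ^ 2) ^ n)‖ := by
        funext n; rw [norm_neg]; congr 1; ring
      rw [this]
      exact aux_summable q (q ^ 2) hq2
    · refine Asymptotics.IsBigO.norm_right ?_
      refine (hO.congr (fun n => ?_) (fun n => ?_))
      · simp only [ht]; ring
      · simp
  have hval : ∑' n, t n = T 0 - q / (1 + q) ^ 2 := by
    refine tendsto_nhds_unique hsum.hasSum.tendsto_sum_nat ?_
    have : ∀ n, ∑ i ∈ Finset.range n, t i = T 0 - T n := fun n => by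
      simp only [htel]; exact Finset.sum_range_sub' T n
    simp only [this]
    exact hTt.const_sub _
  have hlhs : (∑' n : ℕ, q ^ (2 * n + 1) * qPochInf (-q ^ (2 * n + 4)) (q ^ 2) *
        qPochInf (-q ^ (2 * n + 2)) (q ^ 2) / (qPochInf (q ^ (2 * n + 1)) (q ^ 2)) ^ 2)
        = ∑' n, t n := rfl
  rw [hlhs, hval]
  congr 1
  have hE := aux_euler q hq
  rw [aux_one (-q) q hq, show -q * q = -q ^ 2 by ring, sub_neg_eq_add] at hE
  have hB0 : B 0 = qPochInf q (q ^ 2) := by simp [hB]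
  have hA0 : A 0 = qPochInf (-q ^ 2) (q ^ 2) := by simp [hA]
  rw [← hB0] at hE
  rw [← hA0]
  have hb := hBne 0
  have hX : qPochInf (-q ^ 2) q = 1 / ((1 + q) * B 0) := by
    rw [eq_div_iff (mul_ne_zero h1q hb)]; linear_combination hE
  rw [hX]
  simp only [hT]
  field_simp
  norm_num
  ring
end
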